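/- Let n ≥ 1 be a natural number, let X and Y be metric spaces with base points x₀ ∈ X and y₀ ∈ Y, and let μ_X and μ_Y denote the n-dimensional Hausdorff measures on X and Y respectively. Suppose F : Y → X is surjective with F(y₀) = x₀, and there are constants c₁ > 0 and C₂ ≥ 0 such that c₁·dist(y₁,y₂) - C₂ ≤ dist(F(y₁), F(y₂)) ≤ dist(y₁,y₂) for all y₁, y₂ ∈ Y. If there are constants ω > 0, C > 0, ρ₀ > 0 such that μ_X(closed ball of radius ρ about x₀) ≥ ω·ρ^n for all ρ > 0, and μ_Y(closed ball of radius ρ about y₀) ≤ C·ρ^{n-1} for all ρ ≥ ρ₀, then a contradiction follows (no such configuration exists). -/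

import Mathlib

open MeasureTheory Metric

/-- A map that contracts distances by at most an affine amount sends a large ball onto a set
containing a prescribed ball, provided it is surjective. -/
theorem closedBall_subset_image_closedBall_of_mul_dist_sub_le
    {X Y : Type*} [PseudoMetricSpace X] [PseudoMetricSpace Y] {F : Y → X}
    (hsurj : Function.Surjective F) {c a : ℝ} (hc : 0 < c)
    (hlow : ∀ y₁ y₂ : Y, c * dist y₁ y₂ - a ≤ dist (F y₁) (F y₂)) (y₀ : Y) (r : ℝ) :
    closedBall (F y₀) (c * r - a) ⊆ F '' closedBall y₀ r := by
  intro x hx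
  obtain ⟨y, rfl⟩ := hsurj x
  refine ⟨y, ?_, rfl⟩
  rw [mem_closedBall] at hx ⊢
  have h := hlow y y₀
  exact le_of_mul_le_mul_left (by linarith) hc

/-- A power of an affine function with positive slope eventually dominates any multiple of the
next lower power of the variable. -/
theorem exists_mul_pow_pred_lt_mul_affine_pow {n : ℕ} (hn : 1 ≤ n) {c a ω C r₀ : ℝ}
    (hc : 0 < c) (ha : 0 ≤ a) (hω : 0 < ω) (hC : 0 < C) (hr₀ : 0 < r₀) :
    ∃ r, r₀ ≤ r ∧ 0 < c * r - a ∧ C * r ^ (n - 1) < ω * (c * r - a) ^ n := by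
  have hk : 0 < ω * (c / 2) ^ n := by positivity
  have h₁ : 0 ≤ 2 * a / c := by positivity
  have h₂ : 0 < C / (ω * (c / 2) ^ n) := by positivity
  obtain ⟨r, hr⟩ : ∃ r, r = r₀ + 2 * a / c + C / (ω * (c / 2) ^ n) := ⟨_, rfl⟩
  have hr_pos : 0 < r := by linarith
  have hlarge : C < r * (ω * (c / 2) ^ n) := (div_lt_iff₀ hk).1 (by linarith)
  have hhalf : c / 2 * r ≤ c * r - a := by
    have : 2 * a ≤ r * c := (div_le_iff₀ hc).1 (by linarith)
    linarith
  refine ⟨r, by linarith, (by positivity : 0 < c / 2 * r).trans_le hhalf, ?_⟩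
  calc C * r ^ (n - 1) < r * (ω * (c / 2) ^ n) * r ^ (n - 1) := by gcongr
    _ = ω * (c / 2 * r) ^ n := by
      rw [mul_pow, ← pow_sub_one_mul (by lia : n ≠ 0) r]
      ring
    _ ≤ ω * (c * r - a) ^ n := by gcongr

theorem stmt_14 (n : ℕ) (hn : 1 ≤ n)
    {X Y : Type*} [MetricSpace X] [MeasurableSpace X] [BorelSpace X]
    [MetricSpace Y] [MeasurableSpace Y] [BorelSpace Y]
    (x₀ : X) (y₀ : Y) (F : Y → X)
    (hsurj : Function.Surjective F) (hbase : F y₀ = x₀)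
    (c₁ C₂ : ℝ) (hc₁ : 0 < c₁) (hC₂ : 0 ≤ C₂)
    (hlow : ∀ y₁ y₂ : Y, c₁ * dist y₁ y₂ - C₂ ≤ dist (F y₁) (F y₂))
    (hup : ∀ y₁ y₂ : Y, dist (F y₁) (F y₂) ≤ dist y₁ y₂)
    (ω C ρ₀ : ℝ) (hω : 0 < ω) (hC : 0 < C) (hρ₀ : 0 < ρ₀)
    (hX : ∀ ρ : ℝ, 0 < ρ →
      ENNReal.ofReal (ω * ρ ^ n) ≤ μH[(n : ℝ)] (closedBall x₀ ρ))
    (hY : ∀ ρ : ℝ, ρ₀ ≤ ρ →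
      μH[(n : ℝ)] (closedBall y₀ ρ) ≤ ENNReal.ofReal (C * ρ ^ (n - 1))) :
    False := by
  subst hbase
  obtain ⟨r, hr, hpos, hlt⟩ := exists_mul_pow_pred_lt_mul_affine_pow hn hc₁ hC₂ hω hC hρ₀
  have hlip : LipschitzWith 1 F := LipschitzWith.of_dist_le_mul (by simpa using hup)
  have hle : ENNReal.ofReal (ω * (c₁ * r - C₂) ^ n) ≤ ENNReal.ofReal (C * r ^ (n - 1)) :=
    calc ENNReal.ofReal (ω * (c₁ * r - C₂) ^ n)
        ≤ μH[(n : ℝ)] (closedBall (F y₀) (c₁ * r - C₂)) := hX _ hpos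
      _ ≤ μH[(n : ℝ)] (F '' closedBall y₀ r) :=
        measure_mono (closedBall_subset_image_closedBall_of_mul_dist_sub_le hsurj hc₁ hlow y₀ r)
      _ ≤ μH[(n : ℝ)] (closedBall y₀ r) := by
        simpa using hlip.hausdorffMeasure_image_le n.cast_nonneg (closedBall y₀ r)
      _ ≤ ENNReal.ofReal (C * r ^ (n - 1)) := hY r hr
  exact hle.not_gt ((ENNReal.ofReal_lt_ofReal_iff (by positivity)).2 hlt)
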